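/- Let N ≥ 1, p > 1, m ≥ 1. Let a : ℝ^N → ℝ be locally Lipschitz, bounded, with a > 0 a.e., let V ≡ 1, and let f : [0,∞) → ℝ satisfy 0 ≤ f ≤ K for some K > 0. If max(1, p+m−2) < q ≤ p/N + p+m−2, then every global nonnegative weak solution of ∂_t u ≥ (1/a) div(a u^{m−1} |∇u|^{p−2} f(|∇u|) ∇u) + u^q on S = ℝ^N × (0,∞) is zero almost everywhere. (The paper's Corollary 1.4.) -/

import Mathlib

open MeasureTheory Real Set Metric
open scoped ENNReal RealInnerProductSpace

noncomputable section

/-- Euclidean space `ℝ^N`. -/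
abbrev Euc (N : ℕ) : Type := EuclideanSpace ℝ (Fin N)

/-- The parabolic slab `S = ℝ^N × (0,∞)`. -/
def Sset (N : ℕ) : Set (Euc N × ℝ) := {z : Euc N × ℝ | 0 < z.2}

/-- The weighted measure `μ_a = a(x) dx` on `ℝ^N`. -/
def muA {N : ℕ} (a : Euc N → ℝ) : Measure (Euc N) :=
  (volume : Measure (Euc N)).withDensity (fun x => ENNReal.ofReal (a x))

/-- The measure `dμ_a dt` on `ℝ^N × (0,∞)`. -/
def muS {N : ℕ} (a : Euc N → ℝ) : Measure (Euc N × ℝ) :=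
  (muA a).prod ((volume : Measure ℝ).restrict (Set.Ioi (0 : ℝ)))

/-- The continuous linear functional `(w, τ) ↦ ⟪v, w⟫ + c·τ` on `ℝ^N × ℝ`,
encoding a space-time differential with spatial gradient `v` and time derivative `c`. -/
def pairCLM {N : ℕ} (v : Euc N) (c : ℝ) : (Euc N × ℝ) →L[ℝ] ℝ :=
  ((innerSL ℝ v).comp (ContinuousLinearMap.fst ℝ (Euc N) ℝ)) +
    c • (ContinuousLinearMap.snd ℝ (Euc N) ℝ)

/-- `u` is a global nonnegative weak solution of
`∂ₜ u ≥ (1/a) div(a u^{m-1} |∇u|^{p-2} f(|∇u|) ∇u) + V u^q` on `S = ℝ^N × (0,∞)`,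
where `gu`, `ut` are a.e. representatives of the spatial gradient and the time
derivative of `u`. -/
structure IsWeakSol (N : ℕ) (p m q : ℝ) (V : Euc N × ℝ → ℝ) (f : ℝ → ℝ)
    (a : Euc N → ℝ) (u : Euc N × ℝ → ℝ) (gu : Euc N × ℝ → Euc N)
    (ut : Euc N × ℝ → ℝ) : Prop where
  nonneg : ∀ z ∈ Sset N, 0 ≤ u z
  locLip : LocallyLipschitzOn (Sset N) u
  deriv_ae : ∀ᵐ z ∂ ((volume : Measure (Euc N × ℝ)).restrict (Sset N)),
      DifferentiableAt ℝ u z → HasFDerivAt u (pairCLM (gu z) (ut z)) z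
  int_uqV : LocallyIntegrableOn (fun z => u z ^ q * V z) (Sset N) (muS a)
  int_upm : LocallyIntegrableOn (fun z => u z ^ (p + m - 1)) (Sset N) (muS a)
  int_gu : LocallyIntegrableOn (fun z => ‖gu z‖ ^ p * u z ^ (m - 1)) (Sset N) (muS a)
  int_ut : LocallyIntegrableOn (fun z => u z * ut z) (Sset N) (muS a)
  weak_ineq : ∀ (ψ : Euc N × ℝ → ℝ) (gψ : Euc N × ℝ → Euc N) (tψ : Euc N × ℝ → ℝ),
      (∀ z, 0 ≤ ψ z) → LocallyLipschitz ψ → HasCompactSupport ψ →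
      tsupport ψ ⊆ Sset N →
      (∀ᵐ z ∂ (volume : Measure (Euc N × ℝ)),
        DifferentiableAt ℝ ψ z → HasFDerivAt ψ (pairCLM (gψ z) (tψ z)) z) →
      ∫ z, ψ z * u z ^ q * V z ∂ muS a ≤
        (∫ z, ⟪gψ z, gu z⟫ * u z ^ (m - 1) * ‖gu z‖ ^ (p - 2) * f ‖gu z‖ ∂ muS a)
          - ∫ z, tψ z * u z ∂ muS a

/-- The region `E_R = {(x,t) ∈ S : |x|^θ2 + t^θ1 ≤ R^θ2}`. -/
def ESet (N : ℕ) (θ1 θ2 R : ℝ) : Set (Euc N × ℝ) :=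
  {z ∈ Sset N | ‖z.1‖ ^ θ2 + z.2 ^ θ1 ≤ R ^ θ2}

/-- The time cutoff `χ_β`. -/
def chi (β t : ℝ) : ℝ := min 1 (max 0 (t / β - 1))

lemma isOpen_Sset (N : ℕ) : IsOpen (Sset N) := isOpen_lt continuous_const continuous_snd

lemma LocallyLipschitzOn.ae_differentiableAt {E : Type*} [NormedAddCommGroup E] [NormedSpace ℝ E]
    [FiniteDimensional ℝ E] [MeasurableSpace E] [BorelSpace E] (μ : Measure E) [μ.IsAddHaarMeasure]
    {s : Set E} (hs : IsOpen s) {u : E → ℝ} (hu : LocallyLipschitzOn s u) :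
    ∀ᵐ z ∂μ, z ∈ s → DifferentiableAt ℝ u z := by
  rw [ae_iff]
  refine measure_null_of_locally_null _ fun x hx => ?_
  simp only [Classical.not_imp, mem_ofPred_eq] at hx
  obtain ⟨C, t, ht, hC⟩ := hu hx.1
  rw [hs.nhdsWithin_eq hx.1] at ht
  obtain ⟨v, hvt, hvo, hxv⟩ := _root_.mem_nhds_iff.1 ht
  have h := (hC.mono hvt).ae_differentiableWithinAt_of_mem (μ := μ)
  refine ⟨{z | ¬ (z ∈ s → DifferentiableAt ℝ u z)} ∩ v,
    inter_mem_nhdsWithin _ (hvo.mem_nhds hxv), ?_⟩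
  refine measure_mono_null ?_ (ae_iff.1 h)
  rintro z ⟨hz, hzv⟩
  simp only [Classical.not_imp, mem_ofPred_eq] at hz ⊢
  exact ⟨hzv, fun hd => hz.2 (hd.differentiableAt (hvo.mem_nhds hzv))⟩

lemma IsWeakSol.ae_hasFDerivAt {N : ℕ} {p m q : ℝ} {V : Euc N × ℝ → ℝ} {f : ℝ → ℝ}
    {a : Euc N → ℝ} {u : Euc N × ℝ → ℝ} {gu : Euc N × ℝ → Euc N} {ut : Euc N × ℝ → ℝ}
    (hu : IsWeakSol N p m q V f a u gu ut) :
    ∀ᵐ z, z ∈ Sset N → HasFDerivAt u (pairCLM (gu z) (ut z)) z := by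
  have : (volume : Measure (Euc N × ℝ)).IsAddHaarMeasure :=
    inferInstanceAs ((volume : Measure (Euc N)).prod (volume : Measure ℝ)).IsAddHaarMeasure
  have h1 := hu.locLip.ae_differentiableAt volume (isOpen_Sset N)
  have h2 := (ae_restrict_iff' (isOpen_Sset N).measurableSet).1 hu.deriv_ae
  filter_upwards [h1, h2] with z hz1 hz2 hz using hz2 hz (hz1 hz)

/-- The spatial gradient of a function of space and time. -/
def spaceGrad {N : ℕ} (ω : Euc N × ℝ → ℝ) (z : Euc N × ℝ) : Euc N :=
  (InnerProductSpace.toDual ℝ (Euc N)).symm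
    ((fderiv ℝ ω z).comp (ContinuousLinearMap.inl ℝ (Euc N) ℝ))

/-- The time derivative of a function of space and time. -/
def timeDeriv {N : ℕ} (ω : Euc N × ℝ → ℝ) (z : Euc N × ℝ) : ℝ := fderiv ℝ ω z (0, 1)

lemma pairCLM_apply {N : ℕ} (v : Euc N) (c : ℝ) (w : Euc N × ℝ) :
    pairCLM v c w = ⟪v, w.1⟫ + c * w.2 := by
  simp [pairCLM]

lemma pairCLM_spaceGrad_timeDeriv {N : ℕ} (ω : Euc N × ℝ → ℝ) (z : Euc N × ℝ) :
    pairCLM (spaceGrad ω z) (timeDeriv ω z) = fderiv ℝ ω z := by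
  ext w
  · simp [pairCLM_apply, spaceGrad]
  · simp [pairCLM_apply, timeDeriv]

lemma spaceGrad_inner {N : ℕ} (ω : Euc N × ℝ → ℝ) (z : Euc N × ℝ) (v : Euc N) :
    ⟪spaceGrad ω z, v⟫ = fderiv ℝ ω z (v, 0) := by
  simp [spaceGrad]

lemma smul_pairCLM_add {N : ℕ} (b c : ℝ) (v w : Euc N) (s t : ℝ) :
    b • pairCLM v s + c • pairCLM w t = pairCLM (b • v + c • w) (b * s + c * t) := by
  ext x <;> simp [pairCLM_apply, inner_add_left, inner_smul_left]

lemma locallyLipschitz_mul_comp {N : ℕ} {ω u : Euc N × ℝ → ℝ} {F : ℝ → ℝ}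
    (hω : ContDiff ℝ 1 ω) (hsupp : tsupport ω ⊆ Sset N) (hu : LocallyLipschitzOn (Sset N) u)
    (hF : ∀ z ∈ Sset N, ContDiffAt ℝ 1 F (u z)) :
    LocallyLipschitz fun z => ω z * F (u z) := by
  intro z
  by_cases hz : z ∈ Sset N
  · obtain ⟨C₁, t₁, ht₁, h₁⟩ := hu hz
    rw [(isOpen_Sset N).nhdsWithin_eq hz] at ht₁
    obtain ⟨C₂, t₂, ht₂, h₂⟩ := hω.locallyLipschitz z
    have hM : ContDiffAt ℝ 1 (fun y : ℝ × ℝ => y.1 * F y.2) (ω z, u z) :=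
      contDiffAt_fst.mul ((hF z hz).comp (ω z, u z) contDiffAt_snd)
    obtain ⟨C₃, t₃, ht₃, h₃⟩ := hM.exists_lipschitzOnWith
    have hc : ContinuousAt (fun z => (ω z, u z)) z :=
      hω.continuous.continuousAt.prodMk (h₁.continuousOn.continuousAt ht₁)
    refine ⟨C₃ * max C₂ C₁, t₁ ∩ t₂ ∩ (fun z => (ω z, u z)) ⁻¹' t₃,
      Filter.inter_mem (Filter.inter_mem ht₁ ht₂) (hc ht₃), ?_⟩
    have h12 : LipschitzOnWith (max C₂ C₁) (fun z => (ω z, u z))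
        (t₁ ∩ t₂ ∩ (fun z => (ω z, u z)) ⁻¹' t₃) :=
      (h₂.mono fun x hx => hx.1.2).prodMk (h₁.mono fun x hx => hx.1.1)
    exact h₃.comp h12 fun x hx => hx.2
  · refine ⟨0, (tsupport ω)ᶜ, (isClosed_tsupport ω).isOpen_compl.mem_nhds fun h => hz (hsupp h), ?_⟩
    intro x hx y hy
    simp [image_eq_zero_of_notMem_tsupport hx, image_eq_zero_of_notMem_tsupport hy]

lemma continuous_mul_comp {N : ℕ} {ω u : Euc N × ℝ → ℝ} {F : ℝ → ℝ}
    (hω : Continuous ω) (hsupp : tsupport ω ⊆ Sset N) (hu : ContinuousOn u (Sset N))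
    (hF : ∀ z ∈ Sset N, ContinuousAt F (u z)) :
    Continuous fun z => ω z * F (u z) := by
  refine continuous_of_tsupport fun z hz => ?_
  have hzS : z ∈ Sset N := hsupp (tsupport_mul_subset_left hz)
  exact hω.continuousAt.mul (ContinuousAt.comp (f := u) (hF z hzS)
    (hu.continuousAt ((isOpen_Sset N).mem_nhds hzS)))

lemma hasFDerivAt_mul_comp {N : ℕ} {ω u : Euc N × ℝ → ℝ} {F : ℝ → ℝ} {F' : ℝ}
    {z : Euc N × ℝ} {v : Euc N} {c : ℝ}
    (hω : DifferentiableAt ℝ ω z) (hu : HasFDerivAt u (pairCLM v c) z)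
    (hF : HasDerivAt F F' (u z)) :
    HasFDerivAt (fun z => ω z * F (u z))
      (pairCLM (F (u z) • spaceGrad ω z + (ω z * F') • v)
        (F (u z) * timeDeriv ω z + ω z * F' * c)) z := by
  have h := hω.hasFDerivAt.mul (hF.comp_hasFDerivAt z hu)
  rw [← smul_pairCLM_add, pairCLM_spaceGrad_timeDeriv, mul_smul, add_comm]
  exact h

lemma isLocallyFiniteMeasure_muS {N : ℕ} {a : Euc N → ℝ} (ha : Continuous a) :
    IsLocallyFiniteMeasure (muS a) := by
  have : IsLocallyFiniteMeasure (muA a) := by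
    unfold muA
    exact IsLocallyFiniteMeasure.withDensity_ofReal ha
  unfold muS
  infer_instance

lemma muS_absolutelyContinuous {N : ℕ} (a : Euc N → ℝ) :
    muS a ≪ (volume : Measure (Euc N × ℝ)) :=
  (withDensity_absolutelyContinuous _ _).prod Measure.restrict_le_self.absolutelyContinuous

lemma ae_mem_Sset {N : ℕ} (a : Euc N → ℝ) : ∀ᵐ z ∂muS a, z ∈ Sset N := by
  have hSF : SFinite (muA a) := by unfold muA; infer_instance
  have h : muS a = ((muA a).prod volume).restrict (univ ×ˢ Ioi 0) := by
    rw [← Measure.prod_restrict, Measure.restrict_univ, muS]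
  rw [h]
  filter_upwards [ae_restrict_mem (MeasurableSet.univ.prod measurableSet_Ioi)] with z hz
  exact hz.2

lemma integral_timeDeriv_eq_zero {N : ℕ} {a : Euc N → ℝ} [IsLocallyFiniteMeasure (muS a)]
    {Φ : Euc N × ℝ → ℝ} (hΦ : LocallyLipschitz Φ) (hc : HasCompactSupport Φ)
    (hs : tsupport Φ ⊆ Sset N) :
    Integrable (timeDeriv Φ) (muS a) ∧ ∫ z, timeDeriv Φ z ∂muS a = 0 := by
  obtain ⟨T, hT0, hT⟩ : ∃ T > 0, tsupport Φ ⊆ ball 0 T := by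
    obtain ⟨T, hT⟩ := hc.isBounded.subset_ball 0
    exact ⟨max T 1, by positivity, hT.trans (ball_subset_ball (le_max_left _ _))⟩
  have hz0 : ∀ z, z ∉ tsupport Φ → timeDeriv Φ z = 0 := fun z hz => by
    simp [timeDeriv, fderiv_of_notMem_tsupport (𝕜 := ℝ) hz]
  obtain ⟨C, hC⟩ := (hΦ.locallyLipschitzOn (s := closedBall 0 T)).exists_lipschitzOnWith_of_compact
    (isCompact_closedBall 0 T)
  have hbd : ∀ z, ‖timeDeriv Φ z‖ ≤ C := by
    intro z
    by_cases hz : z ∈ ball 0 T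
    · have h1 : ‖fderiv ℝ Φ z‖ ≤ C := norm_fderiv_le_of_lipschitzOn ℝ
        (Filter.mem_of_superset (isOpen_ball.mem_nhds hz) ball_subset_closedBall) hC
      refine ((fderiv ℝ Φ z).le_opNorm _).trans ?_
      simpa [Prod.norm_def] using h1
    · rw [hz0 z fun h => hz (hT h)]
      simp
  have hint : Integrable (timeDeriv Φ) (muS a) := by
    rw [← integrableOn_iff_integrable_of_support_subset (s := tsupport Φ)
      fun z hz => by_contra fun h => hz (hz0 z h)]
    exact Measure.integrableOn_of_bounded hc.measure_lt_top.ne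
      (measurable_fderiv_apply_const ℝ Φ (0, 1)).aestronglyMeasurable
      (Filter.Eventually.of_forall hbd)
  refine ⟨hint, ?_⟩
  have hdiff : ∀ᵐ z ∂muS a, DifferentiableAt ℝ Φ z := by
    have : (volume : Measure (Euc N × ℝ)).IsAddHaarMeasure :=
      inferInstanceAs ((volume : Measure (Euc N)).prod (volume : Measure ℝ)).IsAddHaarMeasure
    have h := (hΦ.locallyLipschitzOn (s := univ)).ae_differentiableAt volume isOpen_univ
    filter_upwards [(muS_absolutelyContinuous a).ae_le h] with z hz using hz trivial
  have hSF : SFinite (muA a) := by unfold muA; infer_instance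
  unfold muS at hint hdiff ⊢
  rw [integral_prod _ hint]
  refine integral_eq_zero_of_ae ?_
  filter_upwards [Measure.ae_ae_of_ae_prod hdiff] with x hx
  have hφ : LocallyLipschitz fun t => Φ (x, t) :=
    hΦ.comp (LipschitzWith.prodMk_left x).locallyLipschitz
  obtain ⟨D, hD⟩ := (hφ.locallyLipschitzOn (s := uIcc 0 T)).exists_lipschitzOnWith_of_compact
    isCompact_uIcc
  have hFTC := hD.absolutelyContinuousOnInterval.integral_deriv_eq_sub
  have e0 : Φ (x, 0) = 0 := image_eq_zero_of_notMem_tsupport fun h => lt_irrefl (0 : ℝ) (hs h)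
  have hout : ∀ t, T ≤ t → (x, t) ∉ tsupport Φ := fun t ht h => by
    have := hT h
    rw [mem_ball_zero_iff, Prod.norm_def] at this
    have h2 := (le_max_right _ _).trans_lt this
    rw [Real.norm_eq_abs] at h2
    exact absurd (le_abs_self t) (by simp only at h2; linarith)
  rw [e0, image_eq_zero_of_notMem_tsupport (hout T le_rfl), sub_zero,
    intervalIntegral.integral_of_le hT0.le] at hFTC
  have hsub : ∫ t in Ioi 0, timeDeriv Φ (x, t) = ∫ t in Ioc 0 T, timeDeriv Φ (x, t) := by
    refine setIntegral_eq_of_subset_of_forall_sdiff_eq_zero measurableSet_Ioi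
      Ioc_subset_Ioi_self fun t ht => hz0 _ (hout t ?_)
    by_contra h
    exact ht.2 (mem_Ioc.2 ⟨mem_Ioi.1 ht.1, (not_le.1 h).le⟩)
  simp only [Pi.zero_apply]
  rw [hsub]
  refine Eq.trans ?_ hFTC
  refine integral_congr_ae ?_
  filter_upwards [ae_restrict_of_ae_restrict_of_subset Ioc_subset_Ioi_self hx] with t ht
  have h := ht.hasFDerivAt.comp_hasDerivAt t ((hasDerivAt_const t x).prodMk (hasDerivAt_id t))
  exact h.deriv.symm

lemma mul_rpow_sub_mul_rpow_le {p A B X : ℝ} (hp : 1 < p) (hA : 0 ≤ A) (hB : 0 < B) (hX : 0 ≤ X) :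
    A * X ^ (p - 1) - B * X ^ p ≤ A ^ p * B ^ (1 - p) := by
  have hXp : X ^ p = X ^ (p - 1) * X := by
    rcases hX.eq_or_lt with rfl | h
    · rw [zero_rpow (by linarith), mul_zero]
    · rw [← rpow_add_one h.ne']; ring_nf
  have h0 : 0 ≤ X ^ (p - 1) := rpow_nonneg hX _
  rcases le_or_gt A (B * X) with h | h
  · have : 0 ≤ A ^ p * B ^ (1 - p) := by positivity
    rw [hXp]
    nlinarith
  · have hA0 : 0 < A := lt_of_le_of_lt (by positivity) h
    have hXA : X ≤ A / B := by rw [le_div_iff₀ hB]; linarith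
    have h1 : X ^ (p - 1) ≤ (A / B) ^ (p - 1) := rpow_le_rpow hX hXA (by linarith)
    have h2 : A * (A / B) ^ (p - 1) = A ^ p * B ^ (1 - p) := by
      rw [div_rpow hA hB.le, div_eq_mul_inv, ← rpow_neg hB.le, ← mul_assoc, mul_comm A,
        ← rpow_add_one hA0.ne']
      ring_nf
    have h3 : 0 ≤ B * X ^ p := by positivity
    rw [← h2]
    nlinarith

lemma flux_le {N : ℕ} {p m K F ω g g' r : ℝ} {w v : Euc N} (hp : 1 < p) (hF0 : 0 ≤ F) (hFK : F ≤ K)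
    (hω : 0 ≤ ω) (hw : ω = 0 → w = 0) (hg : 0 ≤ g) (hg' : g' < 0) (hr : 0 ≤ r) :
    ⟪g • w + (ω * g') • v, v⟫ * r ^ (m - 1) * ‖v‖ ^ (p - 2) * F ≤
      K * r ^ (m - 1) * (g * ‖w‖) ^ p * (ω * |g'|) ^ (1 - p) := by
  have hB : 0 ≤ (g * ‖w‖) ^ p * (ω * |g'|) ^ (1 - p) := by positivity
  have hrm : 0 ≤ r ^ (m - 1) := rpow_nonneg hr _
  have key : ⟪g • w + (ω * g') • v, v⟫ * ‖v‖ ^ (p - 2) ≤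
      (g * ‖w‖) ^ p * (ω * |g'|) ^ (1 - p) := by
    rcases eq_or_ne v 0 with rfl | hv
    · simpa using hB
    have hv0 : 0 < ‖v‖ := norm_pos_iff.2 hv
    rcases hω.eq_or_lt with h | h
    · subst h
      rw [hw rfl] at hB ⊢
      simpa using hB
    · refine le_trans ?_ (mul_rpow_sub_mul_rpow_le hp (by positivity : 0 ≤ g * ‖w‖)
        (by positivity [abs_pos.2 hg'.ne] : 0 < ω * |g'|) hv0.le)
      have e1 : ‖v‖ ^ (p - 1) = ‖v‖ ^ (p - 2) * ‖v‖ := by rw [← rpow_add_one hv0.ne']; ring_nf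
      have e2 : ‖v‖ ^ p = ‖v‖ ^ (p - 2) * ‖v‖ ^ 2 := by
        rw [← rpow_natCast, ← rpow_add hv0]; norm_num
      rw [e1, e2, inner_add_left, inner_smul_left, inner_smul_left, real_inner_self_eq_norm_sq,
        abs_of_neg hg']
      simp only [conj_trivial]
      have h1 : ⟪w, v⟫ ≤ ‖w‖ * ‖v‖ := real_inner_le_norm w v
      have h2 : g * ⟪w, v⟫ ≤ g * (‖w‖ * ‖v‖) := by gcongr
      have h3 : 0 ≤ ‖v‖ ^ (p - 2) := by positivity
      nlinarith
  calc _ = (r ^ (m - 1) * F) * (⟪g • w + (ω * g') • v, v⟫ * ‖v‖ ^ (p - 2)) := by ring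
    _ ≤ (r ^ (m - 1) * F) * ((g * ‖w‖) ^ p * (ω * |g'|) ^ (1 - p)) := by gcongr
    _ ≤ (r ^ (m - 1) * K) * ((g * ‖w‖) ^ p * (ω * |g'|) ^ (1 - p)) := by gcongr
    _ = _ := by ring

lemma eq_zero_fderiv_of_nonneg {E : Type*} [NormedAddCommGroup E] [NormedSpace ℝ E] {ω : E → ℝ}
    (h : ∀ z, 0 ≤ ω z) {z : E} (hz : ω z = 0) : fderiv ℝ ω z = 0 :=
  IsLocalMin.fderiv_eq_zero (Filter.Eventually.of_forall fun y => hz ▸ h y)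

lemma IsWeakSol.integral_mul_le_of_test {N : ℕ} {p m q K : ℝ} {f : ℝ → ℝ} {a : Euc N → ℝ}
    {u : Euc N × ℝ → ℝ} {gu : Euc N × ℝ → Euc N} {ut : Euc N × ℝ → ℝ}
    (hu : IsWeakSol N p m q (fun _ => 1) f a u gu ut) (hp : 1 < p) (hq : 1 < q)
    (hf : ∀ s : ℝ, 0 ≤ s → 0 ≤ f s ∧ f s ≤ K) [IsLocallyFiniteMeasure (muS a)]
    {ω : Euc N × ℝ → ℝ} (hω : ContDiff ℝ 1 ω) (hω0 : ∀ z, 0 ≤ ω z) (hωc : HasCompactSupport ω)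
    (hωS : tsupport ω ⊆ Sset N) {g g' G : ℝ → ℝ}
    (hg : ∀ r, 0 ≤ r → HasDerivAt g (g' r) r) (hG : ∀ r, 0 ≤ r → HasDerivAt G (g r) r)
    (hgC : ∀ r, 0 ≤ r → ContDiffAt ℝ 1 g r) (hGC : ∀ r, 0 ≤ r → ContDiffAt ℝ 1 G r)
    (hg1 : ∀ r, 0 ≤ r → 1 ≤ g r) (hg'0 : ∀ r, 0 ≤ r → g' r < 0)
    {D : Euc N × ℝ → ℝ} (hD : Integrable D (muS a))
    (hDb : ∀ z ∈ Sset N,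
      K * u z ^ (m - 1) * (g (u z) * ‖spaceGrad ω z‖) ^ p * (ω z * |g' (u z)|) ^ (1 - p)
        ≤ D z + timeDeriv ω z * G (u z)) :
    ∫ z, ω z * u z ^ q ∂muS a ≤ ∫ z, D z ∂muS a := by
  have hS := isOpen_Sset N
  have huc : ContinuousOn u (Sset N) := hu.locLip.continuousOn
  have hu0 := hu.nonneg
  have hK : 0 ≤ K := (hf 0 le_rfl).1.trans (hf 0 le_rfl).2
  have hwI := hu.weak_ineq (fun z => ω z * g (u z))
    (fun z => g (u z) • spaceGrad ω z + (ω z * g' (u z)) • gu z)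
    (fun z => g (u z) * timeDeriv ω z + ω z * g' (u z) * ut z) ?_
    (locallyLipschitz_mul_comp hω hωS hu.locLip fun z hz => hgC _ (hu0 z hz))
    hωc.mul_right ((tsupport_mul_subset_left).trans hωS) ?_
  rotate_left
  · intro z
    by_cases hz : z ∈ Sset N
    · exact mul_nonneg (hω0 z) (zero_le_one.trans (hg1 _ (hu0 z hz)))
    · rw [image_eq_zero_of_notMem_tsupport fun h => hz (hωS h), zero_mul]
  · filter_upwards [hu.ae_hasFDerivAt] with z hz _
    by_cases hzS : z ∈ Sset N
    · exact hasFDerivAt_mul_comp (hω.differentiable one_ne_zero z) (hz hzS) (hg _ (hu0 z hzS))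
    · have hzt : z ∉ tsupport ω := fun h => hzS (hωS h)
      have h0 : fderiv ℝ ω z = 0 := fderiv_of_notMem_tsupport (𝕜 := ℝ) hzt
      have hev : (fun z => ω z * g (u z)) =ᶠ[nhds z] fun _ => 0 := by
        filter_upwards [notMem_tsupport_iff_eventuallyEq.1 hzt] with y hy
        rw [hy]; simp
      refine ((hasFDerivAt_const (0 : ℝ) z).congr_of_eventuallyEq hev).congr_fderiv ?_
      rw [image_eq_zero_of_notMem_tsupport hzt]
      ext x <;> simp [pairCLM_apply, spaceGrad, timeDeriv, h0]
  have hcont : ∀ F : ℝ → ℝ, (∀ r, 0 ≤ r → ContinuousAt F r) →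
      Integrable (fun z => ω z * F (u z)) (muS a) := fun F hF =>
    (continuous_mul_comp hω.continuous hωS huc fun z hz =>
      hF _ (hu0 z hz)).integrable_of_hasCompactSupport hωc.mul_right
  have hpow : ∀ r : ℝ, ContinuousAt (fun r : ℝ => r ^ q) r := fun r =>
    continuousAt_rpow_const _ _ (Or.inr (by linarith))
  have hL : ∫ z, ω z * u z ^ q ∂muS a ≤ ∫ z, ω z * g (u z) * u z ^ q * 1 ∂muS a := by
    refine integral_mono_ae (hcont _ fun r _ => hpow r) ?_ ?_
    · simp only [mul_one, mul_assoc]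
      exact hcont (fun r => g r * r ^ q) fun r hr => (hg r hr).continuousAt.mul (hpow r)
    · filter_upwards [ae_mem_Sset a] with z hz
      have h1 := hg1 _ (hu0 z hz)
      have h2 : 0 ≤ ω z * u z ^ q := mul_nonneg (hω0 z) (rpow_nonneg (hu0 z hz) _)
      nlinarith
  have hT : Integrable (fun z => timeDeriv ω z * G (u z)) (muS a) := by
    have hsub : tsupport (timeDeriv ω) ⊆ tsupport ω :=
      closure_minimal (fun z hz => by_contra fun h => hz (by
        simp [timeDeriv, fderiv_of_notMem_tsupport (𝕜 := ℝ) h])) (isClosed_tsupport ω)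
    have hcω : Continuous (timeDeriv ω) :=
      (hω.continuous_fderiv one_ne_zero).clm_apply continuous_const
    exact (continuous_mul_comp hcω (hsub.trans hωS) huc fun z hz =>
      (hG _ (hu0 z hz)).continuousAt).integrable_of_hasCompactSupport
      (HasCompactSupport.mul_right (hωc.of_isClosed_subset (isClosed_tsupport _) hsub))
  have hΦ := integral_timeDeriv_eq_zero (a := a) (Φ := fun z => ω z * (g (u z) * u z - G (u z)))
    (locallyLipschitz_mul_comp (F := fun r => g r * r - G r) hω hωS hu.locLip fun z hz =>
      ((hgC _ (hu0 z hz)).mul contDiffAt_id).sub (hGC _ (hu0 z hz)))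
    hωc.mul_right (tsupport_mul_subset_left.trans hωS)
  have hR : ∫ z, (g (u z) * timeDeriv ω z + ω z * g' (u z) * ut z) * u z ∂muS a =
      ∫ z, timeDeriv ω z * G (u z) ∂muS a := by
    rw [← zero_add (∫ z, timeDeriv ω z * G (u z) ∂muS a), ← hΦ.2, ← integral_add hΦ.1 hT]
    refine integral_congr_ae ?_
    filter_upwards [(muS_absolutelyContinuous a).ae_le hu.ae_hasFDerivAt,
      ae_mem_Sset a] with z hz hzS
    have hd := hasFDerivAt_mul_comp (F := fun r => g r * r - G r)
      (hω.differentiable one_ne_zero z) (hz hzS)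
      (((hg _ (hu0 z hzS)).mul (hasDerivAt_id _)).sub (hG _ (hu0 z hzS)))
    have : timeDeriv (fun z => ω z * (g (u z) * u z - G (u z))) z =
        (g (u z) * u z - G (u z)) * timeDeriv ω z + ω z * (g' (u z) * u z) * ut z := by
      rw [timeDeriv, hd.fderiv, pairCLM_apply]
      simp
    rw [this]
    ring
  have hflux : ∫ z, ⟪g (u z) • spaceGrad ω z + (ω z * g' (u z)) • gu z, gu z⟫ * u z ^ (m - 1) *
      ‖gu z‖ ^ (p - 2) * f ‖gu z‖ ∂muS a ≤ ∫ z, (D z + timeDeriv ω z * G (u z)) ∂muS a := by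
    have hb : ∀ᵐ z ∂muS a, 0 ≤ D z + timeDeriv ω z * G (u z) := by
      filter_upwards [ae_mem_Sset a] with z hz
      refine le_trans ?_ (hDb z hz)
      have := zero_le_one.trans (hg1 _ (hu0 z hz))
      have := hω0 z
      have := hu0 z hz
      positivity
    by_cases hi : Integrable (fun z => ⟪g (u z) • spaceGrad ω z + (ω z * g' (u z)) • gu z, gu z⟫ *
        u z ^ (m - 1) * ‖gu z‖ ^ (p - 2) * f ‖gu z‖) (muS a)
    · refine integral_mono_ae hi (hD.add hT) ?_
      filter_upwards [ae_mem_Sset a] with z hz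
      refine (flux_le hp (hf _ (norm_nonneg _)).1 (hf _ (norm_nonneg _)).2 (hω0 z) (fun h => ?_)
        (zero_le_one.trans (hg1 _ (hu0 z hz))) (hg'0 _ (hu0 z hz)) (hu0 z hz)).trans (hDb z hz)
      simp [spaceGrad, eq_zero_fderiv_of_nonneg hω0 h]
    · rw [integral_undef hi]
      exact integral_nonneg_of_ae hb
  rw [integral_add hD hT] at hflux
  rw [hR] at hwI
  linarith

lemma exists_mul_rpow_le {c s q ε : ℝ} (hc : 0 ≤ c) (hs : 0 ≤ s) (hsq : s < q) (hε : 0 < ε) :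
    ∃ C, 0 ≤ C ∧ ∀ y : ℝ, 0 ≤ y → c * y ^ s ≤ C + ε * y ^ q := by
  set Y : ℝ := (ε / (c + 1)) ^ (s - q)⁻¹ with hY
  have hY0 : 0 < Y := by positivity
  have hYe : Y ^ (s - q) = ε / (c + 1) := by
    rw [hY, ← rpow_mul (by positivity), inv_mul_cancel₀ (by linarith), rpow_one]
  refine ⟨c * Y ^ s, by positivity, fun y hy => ?_⟩
  rcases le_or_gt y Y with h | h
  · have : c * y ^ s ≤ c * Y ^ s := by gcongr
    have : 0 ≤ ε * y ^ q := by positivity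
    linarith
  · have hy0 : 0 < y := hY0.trans h
    have h1 : y ^ (s - q) ≤ ε / (c + 1) := by
      rw [← hYe]
      exact rpow_le_rpow_of_nonpos hY0 h.le (by linarith)
    have h2 : c * y ^ (s - q) ≤ ε := by
      calc c * y ^ (s - q) ≤ (c + 1) * y ^ (s - q) := by gcongr; linarith
        _ ≤ (c + 1) * (ε / (c + 1)) := by gcongr
        _ = ε := by field_simp
    have h3 : y ^ s = y ^ (s - q) * y ^ q := by rw [← rpow_add hy0]; ring_nf
    have h4 : 0 ≤ c * Y ^ s := by positivity
    rw [h3, ← mul_assoc]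
    have : c * y ^ (s - q) * y ^ q ≤ ε * y ^ q := by gcongr
    linarith

lemma exists_mul_rpow_le' {c s q τ : ℝ} (hc : 0 ≤ c) (hs : 0 < s) (hsq : s ≤ q) (hτ : 0 < τ) :
    ∃ C, 0 ≤ C ∧ ∀ y : ℝ, 0 ≤ y → c * y ^ s ≤ τ + C * y ^ q := by
  set Y : ℝ := (τ / (c + 1)) ^ s⁻¹ with hY
  have hY0 : 0 < Y := by positivity
  have hYe : Y ^ s = τ / (c + 1) := by
    rw [hY, ← rpow_mul (by positivity), inv_mul_cancel₀ hs.ne', rpow_one]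
  refine ⟨c * Y ^ (s - q), by positivity, fun y hy => ?_⟩
  rcases le_or_gt y Y with h | h
  · have h1 : c * y ^ s ≤ τ := by
      calc c * y ^ s ≤ (c + 1) * Y ^ s := by gcongr; linarith
        _ = τ := by rw [hYe]; field_simp
    have : 0 ≤ c * Y ^ (s - q) * y ^ q := by positivity
    linarith
  · have hy0 : 0 < y := hY0.trans h
    have h1 : y ^ (s - q) ≤ Y ^ (s - q) := rpow_le_rpow_of_nonpos hY0 h.le (by linarith)
    have h3 : y ^ s = y ^ (s - q) * y ^ q := by rw [← rpow_add hy0]; ring_nf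
    rw [h3, ← mul_assoc]
    have : c * y ^ (s - q) * y ^ q ≤ c * Y ^ (s - q) * y ^ q := by gcongr
    linarith

lemma one_add_rpow_le {y s : ℝ} (hy : 0 ≤ y) (hs : 0 ≤ s) :
    (1 + y) ^ s ≤ 2 ^ s + 2 ^ s * y ^ s := by
  rcases le_or_gt y 1 with h | h
  · have : (1 + y) ^ s ≤ 2 ^ s := rpow_le_rpow (by linarith) (by linarith) hs
    have : 0 ≤ (2 : ℝ) ^ s * y ^ s := by positivity
    linarith
  · have : (1 + y) ^ s ≤ (2 * y) ^ s := rpow_le_rpow (by linarith) (by linarith) hs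
    rw [mul_rpow two_pos.le hy] at this
    have : (0 : ℝ) ≤ 2 ^ s := by positivity
    linarith

lemma exists_half_bound {A B σ q : ℝ} (hA : 0 ≤ A) (hB : 0 ≤ B) (hσ : 0 ≤ σ) (hσq : σ < q)
    (hq : 1 < q) :
    ∃ c, 0 ≤ c ∧ ∀ y : ℝ, 0 ≤ y → A * (1 + y) ^ σ + B * y ≤ c + 1 / 2 * y ^ q := by
  obtain ⟨C₁, hC₁, h₁⟩ := exists_mul_rpow_le (c := A * 2 ^ σ) (by positivity) hσ hσq
    (by norm_num : (0 : ℝ) < 1 / 4)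
  obtain ⟨C₂, hC₂, h₂⟩ := exists_mul_rpow_le hB zero_le_one hq (by norm_num : (0 : ℝ) < 1 / 4)
  refine ⟨A * 2 ^ σ + C₁ + C₂, by positivity, fun y hy => ?_⟩
  have := mul_le_mul_of_nonneg_left (one_add_rpow_le hy hσ) hA
  have h1 := h₁ y hy
  have h2 := h₂ y hy
  rw [rpow_one] at h2
  nlinarith

lemma exists_small_bound {A B σ q e τ : ℝ} (hA : 0 ≤ A) (hB : 0 ≤ B) (hσ : 0 < σ) (hσq : σ < q)
    (hq : 1 < q) (he : 0 < e) (hτ : 0 < τ) :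
    ∃ k, 0 < k ∧ ∃ C, 0 ≤ C ∧ ∀ y : ℝ, 0 ≤ y →
      A * k ^ (-e) * (1 + k * y) ^ σ + B * y ≤ τ + C * y ^ q := by
  set k : ℝ := (τ / 3 / (A * 2 ^ σ + 1)) ^ (-e)⁻¹ with hk
  have hk0 : 0 < k := by positivity
  have hke : k ^ (-e) = τ / 3 / (A * 2 ^ σ + 1) := by
    rw [hk, ← rpow_mul (by positivity), inv_mul_cancel₀ (by linarith), rpow_one]
  have hAk : A * k ^ (-e) * 2 ^ σ ≤ τ / 3 := by
    calc A * k ^ (-e) * 2 ^ σ = (A * 2 ^ σ) * k ^ (-e) := by ring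
      _ ≤ (A * 2 ^ σ + 1) * k ^ (-e) := by gcongr; linarith
      _ = τ / 3 := by rw [hke]; field_simp
  obtain ⟨C₁, hC₁, h₁⟩ := exists_mul_rpow_le' (c := A * k ^ (-e) * 2 ^ σ * k ^ σ) (by positivity)
    hσ hσq.le (by positivity : 0 < τ / 3)
  obtain ⟨C₂, hC₂, h₂⟩ := exists_mul_rpow_le' hB one_pos hq.le (by positivity : 0 < τ / 3)
  refine ⟨k, hk0, C₁ + C₂, by positivity, fun y hy => ?_⟩
  have h3 := mul_le_mul_of_nonneg_left (one_add_rpow_le (by positivity : 0 ≤ k * y) hσ.le)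
    (by positivity : 0 ≤ A * k ^ (-e))
  rw [mul_rpow hk0.le hy] at h3
  have h1 := h₁ y hy
  have h2 := h₂ y hy
  rw [rpow_one] at h2
  nlinarith

/-- The factor `g` of the test function `ω g(u)`. -/
def gFun (d k r : ℝ) : ℝ := 1 + (1 + k * r) ^ (-d)

/-- A primitive of `gFun d k`. -/
def gPrim (d k r : ℝ) : ℝ := r + ((1 + k * r) ^ (1 - d) - 1) / (k * (1 - d))

section gFun

variable {d k r : ℝ}

lemma hasDerivAt_one_add_mul_rpow (s : ℝ) (hk : 0 < k) (hr : 0 ≤ r) :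
    HasDerivAt (fun r => (1 + k * r) ^ s) (k * s * (1 + k * r) ^ (s - 1)) r := by
  have h : HasDerivAt (fun r => 1 + k * r) k r := by
    simpa using ((hasDerivAt_id r).const_mul k).const_add 1
  exact h.rpow_const (Or.inl (by positivity))

lemma contDiffAt_one_add_mul_rpow (s : ℝ) (hk : 0 < k) (hr : 0 ≤ r) :
    ContDiffAt ℝ 1 (fun r => (1 + k * r) ^ s) r :=
  ContDiffAt.rpow_const_of_ne (by fun_prop) (by positivity)

lemma hasDerivAt_gFun (hk : 0 < k) (hr : 0 ≤ r) :
    HasDerivAt (gFun d k) (-(k * d * (1 + k * r) ^ (-d - 1))) r := by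
  refine ((hasDerivAt_one_add_mul_rpow (-d) hk hr).const_add 1).congr_deriv ?_
  ring

lemma hasDerivAt_gPrim (hd : d < 1) (hk : 0 < k) (hr : 0 ≤ r) :
    HasDerivAt (gPrim d k) (gFun d k r) r := by
  refine ((hasDerivAt_id r).add (((hasDerivAt_one_add_mul_rpow (1 - d) hk hr).sub_const
    1).div_const (k * (1 - d)))).congr_deriv ?_
  have : 1 - d ≠ 0 := by linarith
  rw [gFun, show 1 - d - 1 = -d by ring]
  field_simp

lemma contDiffAt_gFun (hk : 0 < k) (hr : 0 ≤ r) : ContDiffAt ℝ 1 (gFun d k) r :=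
  contDiffAt_const.add (contDiffAt_one_add_mul_rpow (-d) hk hr)

lemma contDiffAt_gPrim (hk : 0 < k) (hr : 0 ≤ r) : ContDiffAt ℝ 1 (gPrim d k) r :=
  contDiffAt_id.add (((contDiffAt_one_add_mul_rpow (1 - d) hk hr).sub
    contDiffAt_const).div_const _)

lemma one_le_gFun (hk : 0 < k) (hr : 0 ≤ r) : 1 ≤ gFun d k r := by
  have : 0 ≤ (1 + k * r) ^ (-d) := by positivity
  rw [gFun]; linarith

lemma gFun_le_two (hd : 0 < d) (hk : 0 < k) (hr : 0 ≤ r) : gFun d k r ≤ 2 := by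
  have : (1 + k * r) ^ (-d) ≤ 1 :=
    rpow_le_one_of_one_le_of_nonpos (le_add_of_nonneg_right (by positivity)) (by linarith)
  rw [gFun]; linarith

lemma gPrim_nonneg (hd1 : d < 1) (hk : 0 < k) (hr : 0 ≤ r) : 0 ≤ gPrim d k r := by
  have h1 : 1 ≤ (1 + k * r) ^ (1 - d) :=
    one_le_rpow (le_add_of_nonneg_right (by positivity)) (by linarith)
  have : 0 ≤ ((1 + k * r) ^ (1 - d) - 1) / (k * (1 - d)) :=
    div_nonneg (by linarith) (mul_nonneg hk.le (by linarith))
  rw [gPrim]; linarith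

lemma gPrim_le (hd : 0 < d) (hd1 : d < 1) (hk : 0 < k) (hr : 0 ≤ r) : gPrim d k r ≤ 2 * r := by
  have hkr : 0 ≤ k * r := by positivity
  have h1 : (1 + k * r) ^ (1 - d) ≤ 1 + (1 - d) * (k * r) :=
    rpow_one_add_le_one_add_mul_self (by linarith) (by linarith) (by linarith)
  have : ((1 + k * r) ^ (1 - d) - 1) / (k * (1 - d)) ≤ r := by
    rw [div_le_iff₀ (mul_pos hk (by linarith))]; linarith
  rw [gPrim]; linarith

end gFun

lemma flux_bound_le {K L p m q d k α θ R w r X Z : ℝ} {n : ℕ} (hp : 1 < p)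
    (hm : 1 ≤ m) (hK : 0 ≤ K) (hL : 0 ≤ L) (hd : 0 < d) (hd1 : d < 1) (hk : 0 < k) (hR : 1 ≤ R)
    (hα : α * (q - (p + m - 2)) = p) (hθ : θ = α * (q - 1)) (hq : 1 < q)
    (hn1 : p / n ≤ 1 - ((1 + d) * (p - 1) + (m - 1)) / q) (hn2 : 1 / (n : ℝ) ≤ 1 - 1 / q)
    (hw0 : 0 ≤ w) (hw1 : w ≤ 1) (hr : 0 ≤ r) (hX0 : 0 ≤ X)
    (hX : X ≤ R⁻¹ * (L * w ^ (1 - 1 / (n : ℝ))))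
    (hZ : Z ≤ R ^ (-θ) * (L * w ^ (1 - 1 / (n : ℝ)))) (hXw : w = 0 → X = 0) (hZw : w = 0 → Z = 0) :
    K * r ^ (m - 1) * (gFun d (k * R ^ α) r * X) ^ p *
        (w * |-(k * R ^ α * d * (1 + k * R ^ α * r) ^ (-d - 1))|) ^ (1 - p) +
      Z * gPrim d (k * R ^ α) r ≤
    R ^ (-(α * q)) * (K * (2 * L) ^ p * d ^ (1 - p) * k ^ (-(p + m - 2)) *
      (1 + k * (w ^ (1 / q) * R ^ α * r)) ^ ((1 + d) * (p - 1) + (m - 1)) +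
      2 * L * (w ^ (1 / q) * R ^ α * r)) := by
  have hR0 : 0 < R := by linarith
  set κ : ℝ := k * R ^ α with hκ
  have hκ0 : 0 < κ := by positivity
  set σ := (1 + d) * (p - 1) + (m - 1) with hσ
  have hσ0 : 0 ≤ σ := by
    have : 0 ≤ (1 + d) * (p - 1) := mul_nonneg (by linarith) (by linarith)
    linarith
  set y : ℝ := w ^ (1 / q) * R ^ α * r with hy
  have hy0 : 0 ≤ y := by positivity
  rcases hw0.eq_or_lt with hw | hw
  · rw [hXw hw.symm, hZw hw.symm, mul_zero, zero_rpow (by linarith)]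
    simp only [mul_zero, zero_mul, add_zero]
    positivity
  rw [mul_add]
  set s := 1 + κ * r with hs
  have hs0 : 0 < s := by positivity
  have hg0 : 0 ≤ gFun d κ r := zero_le_one.trans (one_le_gFun hκ0 hr)
  refine add_le_add ?_ ?_
  · have h1 : (gFun d κ r * X) ^ p ≤ (2 * (R⁻¹ * (L * w ^ (1 - 1 / (n : ℝ))))) ^ p := by
      refine rpow_le_rpow (by positivity) ?_ (by linarith)
      exact mul_le_mul (gFun_le_two hd hκ0 hr) hX hX0 (by norm_num)
    have h1' : (2 * (R⁻¹ * (L * w ^ (1 - 1 / (n : ℝ))))) ^ p =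
        (2 * L) ^ p * R ^ (-p) * w ^ ((1 - 1 / (n : ℝ)) * p) := by
      rw [show 2 * (R⁻¹ * (L * w ^ (1 - 1 / (n : ℝ)))) =
        2 * L * R⁻¹ * w ^ (1 - 1 / (n : ℝ)) by ring,
        mul_rpow (by positivity) (by positivity), mul_rpow (by positivity) (by positivity),
        ← rpow_mul hw.le, inv_rpow hR0.le, rpow_neg hR0.le]
    have h2 : r ^ (m - 1) ≤ κ ^ (1 - m) * s ^ (m - 1) := by
      have : r ≤ κ⁻¹ * s := by
        rw [inv_mul_eq_div, le_div_iff₀ hκ0]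
        rw [hs]; linarith
      refine (rpow_le_rpow hr this (by linarith)).trans_eq ?_
      rw [mul_rpow (by positivity) hs0.le, inv_rpow hκ0.le, ← rpow_neg hκ0.le, neg_sub]
    have h3 : (w * |-(κ * d * s ^ (-d - 1))|) ^ (1 - p) =
        w ^ (1 - p) * (κ ^ (1 - p) * d ^ (1 - p) * s ^ ((1 + d) * (p - 1))) := by
      rw [abs_neg, abs_of_nonneg (by positivity), mul_rpow hw.le (by positivity),
        mul_rpow (by positivity) (by positivity), mul_rpow hκ0.le hd.le, ← rpow_mul hs0.le]
      ring_nf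
    have h4 : w ^ ((1 - 1 / (n : ℝ)) * p) * w ^ (1 - p) ≤ w ^ (1 / q * σ) := by
      rw [← rpow_add hw]
      refine rpow_le_rpow_of_exponent_ge hw hw1 ?_
      have : (1 - 1 / (n : ℝ)) * p + (1 - p) = 1 - p / n := by ring
      rw [this]
      have : 1 / q * σ = σ / q := by ring
      linarith
    have h5 : w ^ (1 / q * σ) * s ^ σ ≤ (1 + k * y) ^ σ := by
      rw [rpow_mul hw.le, ← mul_rpow (by positivity) hs0.le]
      refine rpow_le_rpow (by positivity) ?_ hσ0
      have : w ^ (1 / q) ≤ 1 := rpow_le_one hw.le hw1 (by positivity)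
      rw [hs, hκ, hy]
      linarith
    have h6 : R ^ (-p) * (κ ^ (1 - m) * κ ^ (1 - p)) = R ^ (-(α * q)) * k ^ (-(p + m - 2)) := by
      rw [← rpow_add hκ0, hκ, mul_rpow hk.le (by positivity), ← rpow_mul hR0.le,
        show 1 - m + (1 - p) = -(p + m - 2) by ring,
        show -(α * q) = -p + α * -(p + m - 2) by linarith, rpow_add hR0]
      ring
    have h7 : s ^ (m - 1) * s ^ ((1 + d) * (p - 1)) = s ^ σ := by
      rw [← rpow_add hs0, add_comm]
    calc _ ≤ K * (κ ^ (1 - m) * s ^ (m - 1)) *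
          ((2 * L) ^ p * R ^ (-p) * w ^ ((1 - 1 / (n : ℝ)) * p)) *
          (w ^ (1 - p) * (κ ^ (1 - p) * d ^ (1 - p) * s ^ ((1 + d) * (p - 1)))) := by
          rw [← h1', h3]
          gcongr
      _ = K * (2 * L) ^ p * d ^ (1 - p) * (R ^ (-p) * (κ ^ (1 - m) * κ ^ (1 - p))) *
          ((w ^ ((1 - 1 / (n : ℝ)) * p) * w ^ (1 - p)) *
            (s ^ (m - 1) * s ^ ((1 + d) * (p - 1)))) := by ring
      _ ≤ K * (2 * L) ^ p * d ^ (1 - p) * (R ^ (-p) * (κ ^ (1 - m) * κ ^ (1 - p))) *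
          (w ^ (1 / q * σ) * s ^ σ) := by rw [h7]; gcongr
      _ ≤ K * (2 * L) ^ p * d ^ (1 - p) * (R ^ (-p) * (κ ^ (1 - m) * κ ^ (1 - p))) *
          (1 + k * y) ^ σ := by gcongr
      _ = _ := by rw [h6]; ring
  · have h1 : w ^ (1 - 1 / (n : ℝ)) ≤ w ^ (1 / q) :=
      rpow_le_rpow_of_exponent_ge hw hw1 (by linarith)
    have h2 : R ^ (-θ) = R ^ (-(α * q)) * R ^ α := by
      rw [← rpow_add hR0, hθ]; ring_nf
    calc Z * gPrim d κ r ≤ R ^ (-θ) * (L * w ^ (1 - 1 / (n : ℝ))) * (2 * r) :=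
          mul_le_mul hZ (gPrim_le hd hd1 hκ0 hr) (gPrim_nonneg hd1 hκ0 hr) (by positivity)
      _ ≤ R ^ (-θ) * (L * w ^ (1 / q)) * (2 * r) := by gcongr
      _ = _ := by rw [h2, hy]; ring

lemma exists_cutoff (E : Type*) [NormedAddCommGroup E] [NormedSpace ℝ E] [FiniteDimensional ℝ E]
    {n : ℕ} (hn : 2 ≤ n) :
    ∃ (B : E → ℝ) (L : ℝ), 0 ≤ L ∧ ContDiff ℝ 1 B ∧ HasCompactSupport B ∧ (∀ ξ, 0 ≤ B ξ) ∧
      (∀ ξ, B ξ ≤ 1) ∧ (∀ ξ ∈ ball 0 1, B ξ = 1) ∧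
      (∀ ξ ∉ closedBall 0 2 \ ball 0 1, fderiv ℝ B ξ = 0) ∧
      ∀ ξ, ‖fderiv ℝ B ξ‖ ≤ L * B ξ ^ (1 - 1 / (n : ℝ)) := by
  let b : ContDiffBump (0 : E) := ⟨1, 2, one_pos, one_lt_two⟩
  have hb : ContDiff ℝ 1 b := b.contDiff
  obtain ⟨M, hM⟩ := (hb.continuous_fderiv one_ne_zero).bounded_above_of_compact_support
    (b.hasCompactSupport.fderiv ℝ)
  have hM0 : 0 ≤ M := (norm_nonneg _).trans (hM 0)
  have hone : ∀ ξ ∈ ball (0 : E) 1, b ξ = 1 := fun ξ hξ =>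
    b.one_of_mem_closedBall (ball_subset_closedBall hξ)
  refine ⟨fun ξ => b ξ ^ n, n * M, by positivity, hb.pow n, ?_, fun ξ => pow_nonneg b.nonneg n,
    fun ξ => pow_le_one₀ b.nonneg b.le_one, fun ξ hξ => by simp [hone ξ hξ], fun ξ hξ => ?_,
    fun ξ => ?_⟩
  · exact b.hasCompactSupport.comp_left (g := fun r : ℝ => r ^ n) (zero_pow (by omega))
  · have hc : ∃ c : ℝ, (fun ξ => b ξ ^ n) =ᶠ[nhds ξ] fun _ => c := by
      by_cases h : ξ ∈ ball (0 : E) 1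
      · refine ⟨1, ?_⟩
        filter_upwards [isOpen_ball.mem_nhds h] with y hy
        simp [hone y hy]
      · have h2 : ξ ∈ (closedBall (0 : E) 2)ᶜ := fun h2 => hξ ⟨h2, h⟩
        refine ⟨0, ?_⟩
        filter_upwards [isClosed_closedBall.isOpen_compl.mem_nhds h2] with y hy
        have hy2 : ¬ dist y 0 ≤ 2 := fun h => hy (mem_closedBall.2 h)
        rw [b.zero_of_le_dist (not_le.1 hy2).le, zero_pow (by omega)]
    obtain ⟨c, hc⟩ := hc
    rw [hc.fderiv_eq]
    simp
  · have h := ((hb.differentiable one_ne_zero ξ).hasFDerivAt.pow n).fderiv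
    rw [h, norm_smul]
    have hn0 : (n : ℝ) ≠ 0 := by positivity
    have e : (b ξ ^ n : ℝ) ^ (1 - 1 / (n : ℝ)) = b ξ ^ (n - 1) := by
      rw [← rpow_natCast, ← rpow_mul b.nonneg, ← rpow_natCast, Nat.cast_sub (by omega)]
      congr 1
      field_simp
      simp
    rw [e, Real.norm_of_nonneg (by have := b.nonneg (x := ξ); positivity)]
    have h0 : 0 ≤ b ξ ^ (n - 1) := pow_nonneg b.nonneg _
    calc _ ≤ (n • b ξ ^ (n - 1)) * M := 
          mul_le_mul_of_nonneg_left (hM ξ) (by rw [nsmul_eq_mul]; positivity)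
      _ = _ := by rw [nsmul_eq_mul]; ring

/-- The anisotropic scaling `(x, t) ↦ (r x, s t)`. -/
def scaleCLM (N : ℕ) (r s : ℝ) : (Euc N × ℝ) →L[ℝ] (Euc N × ℝ) :=
  (r • ContinuousLinearMap.fst ℝ (Euc N) ℝ).prod (s • ContinuousLinearMap.snd ℝ (Euc N) ℝ)

lemma scaleCLM_apply {N : ℕ} (r s : ℝ) (z : Euc N × ℝ) : scaleCLM N r s z = (r • z.1, s * z.2) :=
  rfl

section scale

variable {N : ℕ} {B : Euc N × ℝ → ℝ} {r s : ℝ}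

lemma fderiv_comp_scaleCLM (hB : Differentiable ℝ B) (z : Euc N × ℝ) :
    fderiv ℝ (fun z => B (scaleCLM N r s z)) z =
      (fderiv ℝ B (scaleCLM N r s z)).comp (scaleCLM N r s) :=
  ((hB _).hasFDerivAt.comp z (scaleCLM N r s).hasFDerivAt).fderiv

lemma norm_spaceGrad_comp_scaleCLM_le (hB : Differentiable ℝ B) (hr : 0 ≤ r) (z : Euc N × ℝ) :
    ‖spaceGrad (fun z => B (scaleCLM N r s z)) z‖ ≤ r * ‖fderiv ℝ B (scaleCLM N r s z)‖ := by
  rw [spaceGrad, LinearIsometryEquiv.norm_map, fderiv_comp_scaleCLM hB]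
  refine ContinuousLinearMap.opNorm_le_bound _ (by positivity) fun v => ?_
  refine ((fderiv ℝ B (scaleCLM N r s z)).le_opNorm (scaleCLM N r s (v, 0))).trans_eq ?_
  simp [scaleCLM_apply, Prod.norm_def, norm_smul, abs_of_nonneg hr,
    max_eq_left (by positivity : 0 ≤ r * ‖v‖)]
  ring

lemma abs_timeDeriv_comp_scaleCLM_le (hB : Differentiable ℝ B) (hs : 0 ≤ s) (z : Euc N × ℝ) :
    |timeDeriv (fun z => B (scaleCLM N r s z)) z| ≤ s * ‖fderiv ℝ B (scaleCLM N r s z)‖ := by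
  rw [timeDeriv, fderiv_comp_scaleCLM hB, ← Real.norm_eq_abs]
  refine ((fderiv ℝ B (scaleCLM N r s z)).le_opNorm (scaleCLM N r s (0, 1))).trans_eq ?_
  simp [scaleCLM_apply, Prod.norm_def, abs_of_nonneg hs, max_eq_right hs]
  ring

end scale

lemma spaceGrad_mul_time {N : ℕ} {W : Euc N × ℝ → ℝ} {χ : ℝ → ℝ} (hW : Differentiable ℝ W)
    (hχ : Differentiable ℝ χ) (z : Euc N × ℝ) :
    spaceGrad (fun z => χ z.2 * W z) z = χ z.2 • spaceGrad W z ∧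
      timeDeriv (fun z => χ z.2 * W z) z = deriv χ z.2 * W z + χ z.2 * timeDeriv W z := by
  have h : fderiv ℝ (fun z => χ z.2 * W z) z =
      χ z.2 • fderiv ℝ W z + W z • (deriv χ z.2 • ContinuousLinearMap.snd ℝ (Euc N) ℝ) :=
    (((hχ z.2).hasDerivAt.comp_hasFDerivAt z hasFDerivAt_snd).mul (hW z).hasFDerivAt).fderiv
  constructor
  · refine ext_inner_right ℝ fun v => ?_
    rw [inner_smul_left, spaceGrad_inner, spaceGrad_inner, h]
    simp
  · rw [timeDeriv, timeDeriv, h]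
    simp
    ring

/-- The region where the cutoff of spatial scale `R` and time scale `R ^ θ` may vary. -/
def annulus (N : ℕ) (θ R : ℝ) : Set (Euc N × ℝ) :=
  scaleCLM N R⁻¹ (R ^ (-θ)) ⁻¹' (closedBall 0 2 \ ball 0 1)

lemma measurableSet_annulus (N : ℕ) (θ R : ℝ) : MeasurableSet (annulus N θ R) :=
  (scaleCLM N R⁻¹ (R ^ (-θ))).continuous.measurable
    (measurableSet_closedBall.diff measurableSet_ball)

lemma annulus_subset {N : ℕ} {θ R : ℝ} (hR : 0 < R) :
    annulus N θ R ⊆ closedBall 0 (2 * R) ×ˢ closedBall 0 (2 * R ^ θ) := by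
  rintro ⟨x, t⟩ ⟨hz, -⟩
  have hRθ : 0 < R ^ θ := by positivity
  rw [scaleCLM_apply, mem_closedBall_zero_iff, Prod.norm_def, max_le_iff, norm_smul, norm_mul,
    rpow_neg hR.le, norm_inv, norm_inv, norm_of_nonneg hR.le, norm_of_nonneg hRθ.le,
    inv_mul_le_iff₀ hR, inv_mul_le_iff₀ hRθ] at hz
  simp only [mem_prod, mem_closedBall_zero_iff]
  exact ⟨by linarith [hz.1], by linarith [hz.2]⟩

lemma exists_measure_annulus_le {N : ℕ} {a : Euc N → ℝ} {Ca α q θ : ℝ} (ha : ∀ x, |a x| ≤ Ca)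
    (hα : (N : ℝ) ≤ α) (hθ : θ = α * (q - 1)) :
    ∃ C, 0 ≤ C ∧ ∀ R, 1 ≤ R → muS a (annulus N θ R) < ∞ ∧
      R ^ (-(α * q)) * (muS a).real (annulus N θ R) ≤ C := by
  have hCa : 0 ≤ Ca := (abs_nonneg _).trans (ha 0)
  set v : ℝ := (volume : Measure (Euc N)).real (ball 0 1) with hv
  refine ⟨Ca * (2 ^ N * v) * 4, by positivity, fun R hR => ?_⟩
  have hR0 : 0 < R := by linarith
  have hle : muS a (annulus N θ R) ≤ ENNReal.ofReal (Ca * ((2 * R) ^ N * v) * (4 * R ^ θ)) := by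
    refine (measure_mono (annulus_subset hR0)).trans ?_
    have hSF : SFinite (muA a) := by unfold muA; infer_instance
    rw [muS, Measure.prod_prod, ENNReal.ofReal_mul (by positivity)]
    refine mul_le_mul' ?_ ?_
    · rw [muA, withDensity_apply _ measurableSet_closedBall, ENNReal.ofReal_mul hCa]
      calc ∫⁻ x in closedBall 0 (2 * R), ENNReal.ofReal (a x)
          ≤ ∫⁻ x in closedBall (0 : Euc N) (2 * R), ENNReal.ofReal Ca :=
            lintegral_mono fun x => ENNReal.ofReal_le_ofReal ((le_abs_self _).trans (ha x))
        _ = ENNReal.ofReal Ca * volume (closedBall (0 : Euc N) (2 * R)) := by simp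
        _ = _ := by
          rw [Measure.addHaar_closedBall _ _ (by positivity), finrank_euclideanSpace_fin,
            ENNReal.ofReal_mul (by positivity), hv, ofReal_measureReal]
    · refine (Measure.restrict_apply_le _ _).trans ?_
      rw [Real.volume_closedBall]
      exact ENNReal.ofReal_le_ofReal (by linarith)
  refine ⟨hle.trans_lt ENNReal.ofReal_lt_top, ?_⟩
  have h1 : (muS a).real (annulus N θ R) ≤ Ca * ((2 * R) ^ N * v) * (4 * R ^ θ) :=
    ENNReal.toReal_le_of_le_ofReal (by positivity) hle
  have h2 : R ^ N * R ^ θ ≤ R ^ (α * q) := by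
    rw [← rpow_natCast, ← rpow_add hR0]
    exact rpow_le_rpow_of_exponent_le hR (by rw [hθ]; linarith)
  calc R ^ (-(α * q)) * (muS a).real (annulus N θ R)
      ≤ R ^ (-(α * q)) * (Ca * ((2 * R) ^ N * v) * (4 * R ^ θ)) := by gcongr
    _ = R ^ (-(α * q)) * (R ^ N * R ^ θ) * (Ca * (2 ^ N * v) * 4) := by rw [mul_pow]; ring
    _ ≤ R ^ (-(α * q)) * R ^ (α * q) * (Ca * (2 ^ N * v) * 4) := by gcongr
    _ = _ := by rw [← rpow_add hR0]; simp

lemma HasCompactSupport.comp_scaleCLM {N : ℕ} {B : Euc N × ℝ → ℝ} {r s : ℝ}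
    (hB : HasCompactSupport B) (hr : r ≠ 0) (hs : s ≠ 0) :
    HasCompactSupport fun z => B (scaleCLM N r s z) :=
  hB.comp_homeomorph
    { toFun := scaleCLM N r s
      invFun := scaleCLM N r⁻¹ s⁻¹
      left_inv := fun z => by simp [scaleCLM_apply, hr, hs]
      right_inv := fun z => by simp [scaleCLM_apply, hr, hs]
      continuous_toFun := (scaleCLM N r s).continuous
      continuous_invFun := (scaleCLM N r⁻¹ s⁻¹).continuous }

/-- The space-time cutoff built from `B` at spatial scale `R` and time scale `R ^ θ`, and removing
the times below `1 / b`. -/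
def cutoff {N : ℕ} (B : Euc N × ℝ → ℝ) (θ R b : ℝ) (z : Euc N × ℝ) : ℝ :=
  smoothTransition (b * z.2 - 1) * B (scaleCLM N R⁻¹ (R ^ (-θ)) z)

section cutoff

variable {N : ℕ} {B : Euc N × ℝ → ℝ} {θ R b : ℝ}

lemma contDiff_cutoff (hB : ContDiff ℝ 1 B) : ContDiff ℝ 1 (cutoff B θ R b) := by
  unfold cutoff
  exact (smoothTransition.contDiff.comp (by fun_prop)).mul
    (hB.comp (scaleCLM N R⁻¹ (R ^ (-θ))).contDiff)

lemma cutoff_nonneg (hB0 : ∀ ξ, 0 ≤ B ξ) (z : Euc N × ℝ) : 0 ≤ cutoff B θ R b z :=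
  mul_nonneg (smoothTransition.nonneg _) (hB0 _)

lemma cutoff_le_one (hB0 : ∀ ξ, 0 ≤ B ξ) (hB1 : ∀ ξ, B ξ ≤ 1) (z : Euc N × ℝ) :
    cutoff B θ R b z ≤ 1 :=
  mul_le_one₀ (smoothTransition.le_one _) (hB0 _) (hB1 _)

lemma hasCompactSupport_cutoff (hB : HasCompactSupport B) (hR : 0 < R) :
    HasCompactSupport (cutoff B θ R b) :=
  (hB.comp_scaleCLM (inv_ne_zero hR.ne') (by positivity)).mul_left

lemma tsupport_cutoff_subset (hb : 0 < b) : tsupport (cutoff B θ R b) ⊆ Sset N := by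
  have hcl : IsClosed {z : Euc N × ℝ | 1 / b ≤ z.2} := isClosed_le continuous_const continuous_snd
  refine (closure_minimal (fun z hz => ?_) hcl).trans fun z (hz : 1 / b ≤ z.2) =>
    lt_of_lt_of_le (by positivity : 0 < 1 / b) hz
  by_contra h
  refine hz ?_
  simp only [mem_ofPred_eq, not_le] at h
  rw [lt_div_iff₀ hb] at h
  rw [cutoff, smoothTransition.zero_of_nonpos (by linarith), zero_mul]

end cutoff

lemma IsWeakSol.integral_cutoff_le {N : ℕ} {p m q K L d k c C α θ R b : ℝ} {n : ℕ} {f : ℝ → ℝ}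
    {a : Euc N → ℝ} {u : Euc N × ℝ → ℝ} {gu : Euc N × ℝ → Euc N} {ut : Euc N × ℝ → ℝ}
    {B : Euc N × ℝ → ℝ}
    (hu : IsWeakSol N p m q (fun _ => 1) f a u gu ut) [IsLocallyFiniteMeasure (muS a)]
    (hp : 1 < p) (hm : 1 ≤ m) (hq : 1 < q) (hK : 0 ≤ K)
    (hf : ∀ s : ℝ, 0 ≤ s → 0 ≤ f s ∧ f s ≤ K)
    (hL : 0 ≤ L) (hB : ContDiff ℝ 1 B) (hBc : HasCompactSupport B) (hB0 : ∀ ξ, 0 ≤ B ξ)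
    (hB1 : ∀ ξ, B ξ ≤ 1) (hBd : ∀ ξ ∉ closedBall 0 2 \ ball 0 1, fderiv ℝ B ξ = 0)
    (hBL : ∀ ξ, ‖fderiv ℝ B ξ‖ ≤ L * B ξ ^ (1 - 1 / (n : ℝ)))
    (hd : 0 < d) (hd1 : d < 1) (hk : 0 < k)
    (hα : α * (q - (p + m - 2)) = p) (hθ : θ = α * (q - 1))
    (hn1 : p / n ≤ 1 - ((1 + d) * (p - 1) + (m - 1)) / q) (hn2 : 1 / (n : ℝ) ≤ 1 - 1 / q)
    (hc : 0 ≤ c)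
    (h : ∀ y, 0 ≤ y → K * (2 * L) ^ p * d ^ (1 - p) * k ^ (-(p + m - 2)) *
      (1 + k * y) ^ ((1 + d) * (p - 1) + (m - 1)) + 2 * L * y ≤ c + C * y ^ q)
    (hR : 1 ≤ R) (hb : 0 < b) (hfin : muS a (annulus N θ R) < ∞) :
    Integrable (fun z => cutoff B θ R b z * u z ^ q) (muS a) ∧
      ∫ z, cutoff B θ R b z * u z ^ q ∂muS a ≤
        c * (R ^ (-(α * q)) * (muS a).real (annulus N θ R)) +
          C * ∫ z in annulus N θ R, cutoff B θ R b z * u z ^ q ∂muS a := by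
  have hR0 : 0 < R := by linarith
  have hωc : HasCompactSupport (cutoff B θ R b) := hasCompactSupport_cutoff hBc hR0
  have hint : Integrable (fun z => cutoff B θ R b z * u z ^ q) (muS a) := by
    refine Continuous.integrable_of_hasCompactSupport ?_ hωc.mul_right
    exact continuous_mul_comp (F := fun r => r ^ q) (contDiff_cutoff hB).continuous
      (tsupport_cutoff_subset hb) hu.locLip.continuousOn
      fun z _ => continuousAt_rpow_const _ _ (Or.inr (by linarith))
  refine ⟨hint, ?_⟩
  have hκ : 0 < k * R ^ α := by positivity
  have hconst : Integrable (fun _ => R ^ (-(α * q)) * c) ((muS a).restrict (annulus N θ R)) :=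
    integrableOn_const hfin.ne
  have hDint : IntegrableOn (fun z => R ^ (-(α * q)) * c + C * (cutoff B θ R b z * u z ^ q))
      (annulus N θ R) (muS a) :=
    hconst.add (hint.integrableOn.const_mul C)
  have key := hu.integral_mul_le_of_test hp hq hf (contDiff_cutoff hB) (cutoff_nonneg hB0) hωc
    (tsupport_cutoff_subset hb) (g := gFun d (k * R ^ α))
    (g' := fun r => -(k * R ^ α * d * (1 + k * R ^ α * r) ^ (-d - 1))) (G := gPrim d (k * R ^ α))
    (fun r hr => hasDerivAt_gFun hκ hr) (fun r hr => hasDerivAt_gPrim hd1 hκ hr)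
    (fun r hr => contDiffAt_gFun hκ hr) (fun r hr => contDiffAt_gPrim hκ hr)
    (fun r hr => one_le_gFun hκ hr) (fun r hr => neg_lt_zero.2 (by positivity))
    (D := (annulus N θ R).indicator
      fun z => R ^ (-(α * q)) * c + C * (cutoff B θ R b z * u z ^ q))
    ((integrable_indicator_iff (measurableSet_annulus N θ R)).2 hDint) ?_
  · refine key.trans_eq ?_
    rw [integral_indicator (measurableSet_annulus N θ R), integral_add hconst
      (hint.integrableOn.const_mul C), setIntegral_const, integral_const_mul, smul_eq_mul]
    ring
  intro z hz
  have hr : 0 ≤ u z := hu.nonneg z hz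
  set r := u z
  set χ : ℝ → ℝ := fun t => smoothTransition (b * t - 1) with hχ
  set W : Euc N × ℝ → ℝ := fun z => B (scaleCLM N R⁻¹ (R ^ (-θ)) z) with hW
  have hBdiff : Differentiable ℝ B := hB.differentiable one_ne_zero
  have hWdiff : Differentiable ℝ W := hBdiff.comp (scaleCLM N R⁻¹ (R ^ (-θ))).differentiable
  have hχdiff : Differentiable ℝ χ :=
    (smoothTransition.contDiff (n := 1)).differentiable one_ne_zero |>.comp (by fun_prop)
  obtain ⟨e1, e2⟩ := spaceGrad_mul_time hWdiff hχdiff z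
  change K * r ^ (m - 1) * (gFun d (k * R ^ α) r * ‖spaceGrad (fun z => χ z.2 * W z) z‖) ^ p *
    (χ z.2 * W z * |-(k * R ^ α * d * (1 + k * R ^ α * r) ^ (-d - 1))|) ^ (1 - p) ≤
    _ + timeDeriv (fun z => χ z.2 * W z) z * gPrim d (k * R ^ α) r
  have hχ0 : 0 ≤ χ z.2 := smoothTransition.nonneg _
  have hχ1 : χ z.2 ≤ 1 := smoothTransition.le_one _
  have hχ' : 0 ≤ deriv χ z.2 := Monotone.deriv_nonneg (fun s t hst =>
    smoothTransition.monotone (by nlinarith))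
  have hw0 : 0 ≤ W z := hB0 _
  have hw1 : W z ≤ 1 := hB1 _
  have hG : 0 ≤ gPrim d (k * R ^ α) r := gPrim_nonneg hd1 hκ hr
  have hg : 0 ≤ gFun d (k * R ^ α) r := zero_le_one.trans (one_le_gFun hκ hr)
  have hX := norm_spaceGrad_comp_scaleCLM_le (r := R⁻¹) (s := R ^ (-θ)) hBdiff (by positivity) z
  have hZ := abs_timeDeriv_comp_scaleCLM_le (r := R⁻¹) (s := R ^ (-θ)) hBdiff (by positivity) z
  have hBz := hBL (scaleCLM N R⁻¹ (R ^ (-θ)) z)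
  rw [e1, e2, norm_smul, norm_of_nonneg hχ0]
  set g := gFun d (k * R ^ α) r
  set G := gPrim d (k * R ^ α) r
  set γ := |-(k * R ^ α * d * (1 + k * R ^ α * r) ^ (-d - 1))| with hγ
  set X := ‖spaceGrad W z‖ with hXdef
  have hX0 : 0 ≤ X := norm_nonneg _
  have hγ0 : 0 ≤ γ := abs_nonneg _
  have hlhs : K * r ^ (m - 1) * (g * (χ z.2 * X)) ^ p * (χ z.2 * W z * γ) ^ (1 - p) =
      χ z.2 * (K * r ^ (m - 1) * (g * X) ^ p * (W z * γ) ^ (1 - p)) := by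
    rcases hχ0.eq_or_lt with h0 | h0
    · rw [← h0, zero_mul, mul_zero, zero_rpow (by linarith)]
      ring
    · rw [mul_left_comm, mul_assoc (χ z.2), mul_rpow hχ0 (by positivity),
        mul_rpow hχ0 (by positivity)]
      have : χ z.2 ^ p * χ z.2 ^ (1 - p) = χ z.2 := by rw [← rpow_add h0]; simp
      linear_combination (K * r ^ (m - 1) * (g * X) ^ p * (W z * γ) ^ (1 - p)) * this
  rw [hlhs]
  have hdrop : 0 ≤ deriv χ z.2 * W z * G := by positivity
  by_cases hzA : z ∈ annulus N θ R
  · rw [indicator_of_mem hzA]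
    have hzero : W z = 0 → X = 0 ∧ |timeDeriv W z| = 0 := fun h0 => by
      have := eq_zero_fderiv_of_nonneg hB0 h0
      rw [this, norm_zero, mul_zero] at hX hZ
      exact ⟨le_antisymm hX hX0, le_antisymm hZ (abs_nonneg _)⟩
    have hfl := flux_bound_le (Z := |timeDeriv W z|) (R := R) hp hm hK hL hd hd1 hk hR hα hθ hq
      hn1 hn2 hw0 hw1 hr hX0 (hX.trans (by gcongr)) (hZ.trans (by gcongr))
      (fun h0 => (hzero h0).1) (fun h0 => (hzero h0).2)
    have hy := h (W z ^ (1 / q) * R ^ α * r) (by positivity)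
    have hyq : (W z ^ (1 / q) * R ^ α * r) ^ q = R ^ (α * q) * (W z * r ^ q) := by
      rw [mul_rpow (by positivity) hr, mul_rpow (by positivity) (by positivity), ← rpow_mul hw0,
        one_div_mul_cancel (by linarith), rpow_one, ← rpow_mul hR0.le]
      ring
    have hRR : R ^ (-(α * q)) * R ^ (α * q) = 1 := by rw [← rpow_add hR0]; simp
    have hmul : R ^ (-(α * q)) * (c + C * (W z ^ (1 / q) * R ^ α * r) ^ q) =
        R ^ (-(α * q)) * c + C * (W z * r ^ q) := by
      rw [hyq]
      linear_combination (C * (W z * r ^ q)) * hRR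
    have hfinal := mul_le_mul_of_nonneg_left
      (hfl.trans ((mul_le_mul_of_nonneg_left hy (by positivity)).trans_eq hmul)) hχ0
    have h1 : χ z.2 * (R ^ (-(α * q)) * c) ≤ R ^ (-(α * q)) * c :=
      mul_le_of_le_one_left (by positivity) hχ1
    have h2 : -(χ z.2 * |timeDeriv W z| * G) ≤ χ z.2 * timeDeriv W z * G := by
      have := mul_le_mul_of_nonneg_left (neg_abs_le (timeDeriv W z)) hχ0
      nlinarith
    have h3 : cutoff B θ R b z = χ z.2 * W z := rfl
    rw [h3]
    linarith
  · have h0 : fderiv ℝ B (scaleCLM N R⁻¹ (R ^ (-θ)) z) = 0 := hBd _ hzA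
    rw [h0, norm_zero, mul_zero] at hX hZ
    rw [indicator_of_notMem hzA, le_antisymm hX hX0,
      abs_nonpos_iff.1 hZ, mul_zero, zero_rpow (by linarith)]
    linarith

lemma lintegral_ofReal_le_of_integral_le {X : Type*} [MeasurableSpace X] {μ : Measure X}
    {F : ℕ → X → ℝ} {f : X → ℝ} {M : ℝ} {ε : ℕ → ℝ} (hF : ∀ k, Integrable (F k) μ)
    (h0 : ∀ᵐ z ∂μ, ∀ k, 0 ≤ F k z)
    (hlim : ∀ᵐ z ∂μ, Filter.Tendsto (fun k => F k z) Filter.atTop (nhds (f z)))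
    (hM : ∀ k, ∫ z, F k z ∂μ ≤ M + ε k) (hε : Filter.Tendsto ε Filter.atTop (nhds 0)) :
    ∫⁻ z, ENNReal.ofReal (f z) ∂μ ≤ ENNReal.ofReal M := by
  have h1 : ∫⁻ z, ENNReal.ofReal (f z) ∂μ =
      ∫⁻ z, Filter.liminf (fun k => ENNReal.ofReal (F k z)) Filter.atTop ∂μ := by
    refine lintegral_congr_ae ?_
    filter_upwards [hlim] with z hz
    exact (ENNReal.tendsto_ofReal hz).liminf_eq.symm
  have h2 : Filter.Tendsto (fun k => ENNReal.ofReal (M + ε k)) Filter.atTop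
      (nhds (ENNReal.ofReal M)) := by
    simpa using ENNReal.tendsto_ofReal (hε.const_add M)
  rw [h1, ← h2.liminf_eq]
  refine (lintegral_liminf_le' fun k => (hF k).aemeasurable.ennreal_ofReal).trans ?_
  refine Filter.liminf_le_liminf (Filter.Eventually.of_forall fun k => ?_)
  rw [← ofReal_integral_eq_lintegral_ofReal (hF k) (h0.mono fun z hz => hz k)]
  exact ENNReal.ofReal_le_ofReal (hM k)

lemma ae_eq_zero_of_integral_le {X : Type*} [MeasurableSpace X] {μ : Measure X}
    {F : ℕ → X → ℝ} {f : X → ℝ} {A : ℕ → Set X} {M : ℝ} (hF : ∀ k, Integrable (F k) μ)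
    (h0 : ∀ᵐ z ∂μ, ∀ k, 0 ≤ F k z) (hFf : ∀ᵐ z ∂μ, ∀ k, F k z ≤ f z)
    (hlim : ∀ᵐ z ∂μ, Filter.Tendsto (fun k => F k z) Filter.atTop (nhds (f z)))
    (hA : ∀ k, MeasurableSet (A k)) (hAz : ∀ z, ∀ᶠ k in Filter.atTop, z ∉ A k)
    (hM : ∀ k, ∫ z, F k z ∂μ ≤ M)
    (hsmall : ∀ τ > 0, ∃ C, ∀ k, ∫ z, F k z ∂μ ≤ τ + C * ∫ z in A k, F k z ∂μ) :
    ∀ᵐ z ∂μ, f z = 0 := by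
  have hf0 : ∀ᵐ z ∂μ, 0 ≤ f z := by
    filter_upwards [h0, hFf] with z h1 h2 using (h1 0).trans (h2 0)
  have hfm : AEStronglyMeasurable f μ :=
    aestronglyMeasurable_of_tendsto_ae Filter.atTop (fun k => (hF k).1) hlim
  have hfint : Integrable f μ := by
    refine ⟨hfm, ?_⟩
    rw [hasFiniteIntegral_iff_ofReal hf0]
    refine (lintegral_ofReal_le_of_integral_le (ε := fun _ => 0) hF h0 hlim (M := M)
      (by simpa using hM) tendsto_const_nhds).trans_lt ENNReal.ofReal_lt_top
  have htail : Filter.Tendsto (fun k => ∫ z in A k, F k z ∂μ) Filter.atTop (nhds 0) := by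
    have h := tendsto_integral_of_dominated_convergence (μ := μ)
      (F := fun k => (A k).indicator (F k)) (f := fun _ => (0 : ℝ)) f
      (fun k => ((hF k).indicator (hA k)).1) hfint (fun k => ?_) ?_
    · simpa [integral_indicator (hA _)] using h
    · filter_upwards [h0, hFf] with z h1 h2
      refine (norm_indicator_le_norm_self _ _).trans ?_
      rw [norm_of_nonneg (h1 k)]
      exact h2 k
    · refine Filter.Eventually.of_forall fun z => tendsto_const_nhds.congr' ?_
      filter_upwards [hAz z] with k hk
      rw [indicator_of_notMem hk]
  have hle : ∀ τ : ℝ, 0 < τ → ∫⁻ z, ENNReal.ofReal (f z) ∂μ ≤ ENNReal.ofReal τ := by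
    intro τ hτ
    obtain ⟨C, hC⟩ := hsmall τ hτ
    exact lintegral_ofReal_le_of_integral_le hF h0 hlim hC (by simpa using htail.const_mul C)
  have hzero : ∫⁻ z, ENNReal.ofReal (f z) ∂μ = 0 := by
    refine le_antisymm (ENNReal.le_of_forall_pos_le_add fun τ hτ _ => ?_) zero_le
    simpa using hle τ hτ
  rw [lintegral_eq_zero_iff' hfm.aemeasurable.ennreal_ofReal] at hzero
  filter_upwards [hzero, hf0] with z h1 h2
  exact le_antisymm (ENNReal.ofReal_eq_zero.1 h1) h2

lemma eventually_scaleCLM_mem_ball {N : ℕ} {θ : ℝ} (hθ : 0 < θ) (z : Euc N × ℝ) :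
    ∀ᶠ k : ℕ in Filter.atTop,
      scaleCLM N ((k : ℝ) + 1)⁻¹ (((k : ℝ) + 1) ^ (-θ)) z ∈ ball 0 1 := by
  have hk : Filter.Tendsto (fun k : ℕ => (k : ℝ) + 1) Filter.atTop Filter.atTop :=
    Filter.tendsto_atTop_add_const_right _ _ tendsto_natCast_atTop_atTop
  have h1 := (tendsto_inv_atTop_zero.comp hk).smul_const z.1
  have h2 := ((tendsto_rpow_neg_atTop hθ).comp hk).mul_const z.2
  have h := h1.prodMk_nhds h2
  rw [zero_smul, zero_mul] at h
  exact h (ball_mem_nhds 0 one_pos)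

lemma eventually_cutoff_eq_one {N : ℕ} {B : Euc N × ℝ → ℝ} {θ : ℝ} (hθ : 0 < θ)
    (hB : ∀ ξ ∈ ball 0 1, B ξ = 1) {z : Euc N × ℝ} (hz : z ∈ Sset N) :
    ∀ᶠ k : ℕ in Filter.atTop, cutoff B θ ((k : ℝ) + 1) ((k : ℝ) + 1) z = 1 := by
  have hz : 0 < z.2 := hz
  filter_upwards [eventually_scaleCLM_mem_ball hθ z,
    tendsto_natCast_atTop_atTop.eventually_ge_atTop (2 / z.2)] with k h1 h2
  have h3 : 2 ≤ (k : ℝ) * z.2 := (div_le_iff₀ hz).1 h2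
  rw [cutoff, hB _ h1, smoothTransition.one_of_one_le (by linarith), mul_one]

lemma volume_restrict_Sset_absolutelyContinuous {N : ℕ} {a : Euc N → ℝ} (ha : Continuous a)
    (haPos : ∀ᵐ x, 0 < a x) : (volume : Measure (Euc N × ℝ)).restrict (Sset N) ≪ muS a := by
  have hvol : (volume : Measure (Euc N)) ≪ muA a := by
    refine withDensity_absolutelyContinuous' ha.measurable.ennreal_ofReal.aemeasurable ?_
    filter_upwards [haPos] with x hx
    simpa using hx
  have hS : Sset N = univ ×ˢ Ioi 0 := by
    ext z
    simp [Sset]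
  have hSF : SFinite (muA a) := by unfold muA; infer_instance
  rw [hS, Measure.volume_eq_prod, ← Measure.prod_restrict, Measure.restrict_univ]
  exact hvol.prod Measure.AbsolutelyContinuous.rfl

lemma exists_exponents {p m q : ℝ} (hp : 1 < p) (hq : 1 < q) (hpm : p + m - 2 < q) :
    ∃ (d : ℝ) (n : ℕ), 0 < d ∧ d < 1 ∧ 2 ≤ n ∧ (1 + d) * (p - 1) + (m - 1) < q ∧
      p / n ≤ 1 - ((1 + d) * (p - 1) + (m - 1)) / q ∧ 1 / (n : ℝ) ≤ 1 - 1 / q := by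
  have hp1 : 0 < p - 1 := by linarith
  have hq0 : 0 < q - (p + m - 2) := by linarith
  set d := min (1 / 2) ((q - (p + m - 2)) / (2 * (p - 1))) with hd
  have hd0 : 0 < d := by positivity
  have hd1 : d * (2 * (p - 1)) ≤ q - (p + m - 2) :=
    (le_div_iff₀ (by positivity)).1 (min_le_right _ _)
  have hσ : (1 + d) * (p - 1) + (m - 1) < q := by linarith
  have h1 : 0 < 1 - ((1 + d) * (p - 1) + (m - 1)) / q := by
    rw [sub_pos, div_lt_one (by linarith)]
    exact hσ
  have h2 : 0 < 1 - 1 / q := by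
    rw [sub_pos, div_lt_one (by linarith)]
    exact hq
  obtain ⟨n, hn⟩ := exists_nat_ge (max 2 (max (p / (1 - ((1 + d) * (p - 1) + (m - 1)) / q))
    (1 / (1 - 1 / q))))
  simp only [max_le_iff] at hn
  have hn0 : (0 : ℝ) < n := by linarith [hn.1]
  refine ⟨d, n, hd0, (min_le_left _ _).trans_lt (by norm_num), by exact_mod_cast hn.1, hσ, ?_, ?_⟩
  · rw [div_le_iff₀ hn0, ← div_le_iff₀' h1]
    exact hn.2.1
  · rw [div_le_iff₀ hn0, ← div_le_iff₀' h2]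
    exact hn.2.2

lemma IsWeakSol.ae_muS_rpow_eq_zero {N : ℕ} {p m q K Ca : ℝ} {f : ℝ → ℝ} {a : Euc N → ℝ}
    {u : Euc N × ℝ → ℝ} {gu : Euc N × ℝ → Euc N} {ut : Euc N × ℝ → ℝ}
    (hu : IsWeakSol N p m q (fun _ => 1) f a u gu ut) (hN : 1 ≤ N)
    (hp : 1 < p) (hm : 1 ≤ m) (hq : 1 < q) (hK : 0 ≤ K)
    (hf : ∀ s : ℝ, 0 ≤ s → 0 ≤ f s ∧ f s ≤ K) (ha : Continuous a) (haBdd : ∀ x, |a x| ≤ Ca)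
    (hq1 : p + m - 2 < q) (hq2 : q ≤ p / (N : ℝ) + p + m - 2) :
    ∀ᵐ z ∂muS a, u z ^ q = 0 := by
  have := isLocallyFiniteMeasure_muS ha
  obtain ⟨d, n, hd, hd1, hn, hσq, hn1, hn2⟩ := exists_exponents hp hq hq1
  obtain ⟨B, L, hL, hB, hBc, hB0, hB1, hBone, hBd, hBL⟩ := exists_cutoff (Euc N × ℝ) hn
  have hN0 : (0 : ℝ) < N := by exact_mod_cast hN
  have hgap : 0 < q - (p + m - 2) := by linarith
  set α := p / (q - (p + m - 2)) with hαdef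
  have hα : α * (q - (p + m - 2)) = p := div_mul_cancel₀ _ hgap.ne'
  have hαN : (N : ℝ) ≤ α := by
    rw [hαdef, le_div_iff₀ hgap, ← le_div_iff₀' hN0]
    linarith
  obtain ⟨Cv, hCv, hvol⟩ := exists_measure_annulus_le haBdd hαN (rfl : α * (q - 1) = α * (q - 1))
  set θ := α * (q - 1) with hθ
  have hθ0 : 0 < θ := mul_pos (by linarith) (by linarith)
  have hR : ∀ k : ℕ, (1 : ℝ) ≤ k + 1 := fun k => by simp
  have hσ0 : 0 < (1 + d) * (p - 1) + (m - 1) :=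
    add_pos_of_pos_of_nonneg (mul_pos (by linarith) (by linarith)) (by linarith)
  have hest := fun {k c C : ℝ} (hk : 0 < k) (hc : 0 ≤ c)
      (h : ∀ y, 0 ≤ y → K * (2 * L) ^ p * d ^ (1 - p) * k ^ (-(p + m - 2)) *
        (1 + k * y) ^ ((1 + d) * (p - 1) + (m - 1)) + 2 * L * y ≤ c + C * y ^ q) (j : ℕ) =>
    hu.integral_cutoff_le (b := (j : ℝ) + 1) hp hm hq hK hf hL hB hBc hB0 hB1 hBd hBL hd hd1 hk
      hα hθ hn1 hn2 hc h (hR j) (by positivity) (hvol _ (hR j)).1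
  obtain ⟨c, hc, hhalf⟩ := exists_half_bound (A := K * (2 * L) ^ p * d ^ (1 - p)) (B := 2 * L)
    (by positivity) (by positivity) hσ0.le hσq hq
  have hest1 := hest one_pos hc (by simpa using hhalf)
  have h0 : ∀ᵐ z ∂muS a, ∀ j : ℕ,
      0 ≤ cutoff B θ ((j : ℝ) + 1) ((j : ℝ) + 1) z * u z ^ q := by
    filter_upwards [ae_mem_Sset a] with z hz j
    exact mul_nonneg (cutoff_nonneg hB0 _) (rpow_nonneg (hu.nonneg z hz) _)
  refine ae_eq_zero_of_integral_le (M := 2 * (c * Cv))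
    (A := fun j : ℕ => annulus N θ ((j : ℝ) + 1))
    (F := fun j z => cutoff B θ ((j : ℝ) + 1) ((j : ℝ) + 1) z * u z ^ q)
    (fun j => (hest1 j).1) h0 ?_ ?_ (fun j => measurableSet_annulus _ _ _) (fun z => ?_)
    (fun j => ?_) fun τ hτ => ?_
  · filter_upwards [ae_mem_Sset a] with z hz j
    exact mul_le_of_le_one_left (rpow_nonneg (hu.nonneg z hz) _) (cutoff_le_one hB0 hB1 z)
  · filter_upwards [ae_mem_Sset a] with z hz
    refine tendsto_const_nhds.congr' ?_
    filter_upwards [eventually_cutoff_eq_one hθ0 hBone hz] with j hj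
    rw [hj, one_mul]
  · filter_upwards [eventually_scaleCLM_mem_ball hθ0 z] with j hj h
    exact h.2 hj
  · have h1 := (hest1 j).2
    have h2 := setIntegral_le_integral (s := annulus N θ ((j : ℝ) + 1)) (hest1 j).1
      (h0.mono fun z hz => hz j)
    have h3 := mul_le_mul_of_nonneg_left (hvol _ (hR j)).2 hc
    linarith
  · obtain ⟨k, hk, C, -, hkC⟩ := exists_small_bound (A := K * (2 * L) ^ p * d ^ (1 - p))
      (B := 2 * L) (e := p + m - 2) (τ := τ / (Cv + 1)) (by positivity) (by positivity) hσ0 hσq hq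
      (by linarith) (by positivity)
    refine ⟨C, fun j => ((hest hk (by positivity) hkC j).2).trans ?_⟩
    gcongr
    calc τ / (Cv + 1) * _ ≤ τ / (Cv + 1) * (Cv + 1) := by
          gcongr
          linarith [(hvol _ (hR j)).2]
      _ = τ := div_mul_cancel₀ _ (by positivity)

/-- Corollary 1.4: nonexistence on ℝ^N with `V ≡ 1` and bounded weight `a`. -/
theorem corollary_euclidean_nonexistence
    (N : ℕ) (hN : 1 ≤ N) (p m q K : ℝ)
    (hp : 1 < p) (hm : 1 ≤ m) (hK : 0 < K)
    (f : ℝ → ℝ) (a : Euc N → ℝ)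
    (hf : ∀ s : ℝ, 0 ≤ s → 0 ≤ f s ∧ f s ≤ K)
    (haLip : LocallyLipschitz a)
    (haPos : ∀ᵐ x ∂ (volume : Measure (Euc N)), 0 < a x)
    (haBdd : ∃ Ca : ℝ, ∀ x, |a x| ≤ Ca)
    (hq1 : max 1 (p + m - 2) < q) (hq2 : q ≤ p / (N : ℝ) + p + m - 2)
    (u : Euc N × ℝ → ℝ) (gu : Euc N × ℝ → Euc N) (ut : Euc N × ℝ → ℝ)
    (hu : IsWeakSol N p m q (fun _ => 1) f a u gu ut) :
    ∀ᵐ z ∂ ((volume : Measure (Euc N × ℝ)).restrict (Sset N)), u z = 0 := by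
  obtain ⟨Ca, hCa⟩ := haBdd
  have hq : 1 < q := (le_max_left _ _).trans_lt hq1
  have h := hu.ae_muS_rpow_eq_zero hN hp hm hq hK.le hf haLip.continuous hCa
    ((le_max_right _ _).trans_lt hq1) hq2
  filter_upwards [(volume_restrict_Sset_absolutelyContinuous haLip.continuous haPos).ae_le h,
    ae_restrict_mem (isOpen_Sset N).measurableSet] with z hz hzS
  exact (rpow_eq_zero (hu.nonneg z hzS) (by linarith)).1 hz

end
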